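/- arXiv:1509.06962 — 3 statements merged into one kernel-verified Lean document; each statement's English description precedes it below -/
import Mathlib

section
/- The normalization algorithm is correct: for every multi-valued regulatory graph G, every parametrization K ∈ K_G, every component v∈V and every regulatory context ω∈Ω_v, the recursion Norm(K,v,ω) terminates and Norm(K,v,ω) = (F^K_v)^mon(ω), the common monotone target value of all states in ω. -/
/-!
Formalization of multi-valued regulatory graphs (Thomas networks),
their parametrizations, asynchronous transition systems,
canonization, completion, normalization and minimization.
-/

namespace MVReg

open Classical

/-- A multi-valued regulatory graph over components `V` with maximal
activity levels `ρ`: a finite set of regulations `(u, n, v)` with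
threshold `0 < n ≤ ρ u`. -/
structure RegGraph (V : Type*) (ρ : V → ℕ) where
  E : Finset (V × ℕ × V)
  valid : ∀ e ∈ E, 1 ≤ e.2.1 ∧ e.2.1 ≤ ρ e.1

/-- A (total) parametrization candidate: a value for each component and
each potential regulatory context (a context assigns to each regulator
an interval, represented by its pair of endpoints `[j, k)`). -/
abbrev Param (V : Type*) := V → (V → ℕ × ℕ) → ℕ

variable {V : Type*} [DecidableEq V] [Fintype V] {ρ : V → ℕ}

/-- The extended threshold set `Θ(u,v) = θ(u,v) ∪ {0, ρ u + 1}`. -/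
def Theta (G : RegGraph V ρ) (u v : V) : Set ℕ :=
  {m | (u, m, v) ∈ G.E} ∪ {0, ρ u + 1}

/-- Activity intervals `I_v^u`: pairs `(j,k)` (representing `[j,k)`) of
consecutive members of `Θ(u,v)`. -/
def ActInterval (G : RegGraph V ρ) (u v : V) : Set (ℕ × ℕ) :=
  {p | p.1 ∈ Theta G u v ∧ p.2 ∈ Theta G u v ∧ p.1 < p.2 ∧
    ∀ l ∈ Theta G u v, ¬ (p.1 < l ∧ l < p.2)}

/-- The regulatory contexts `Ω_v` of a component `v`. -/
def Context (G : RegGraph V ρ) (v : V) : Set (V → ℕ × ℕ) :=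
  {ω | ∀ u, ω u ∈ ActInterval G u v}

/-- `K ∈ 𝒦_G` : on every regulatory context of `v` the value lies in `[0, ρ v]`. -/
def IsParam (G : RegGraph V ρ) (K : Param V) : Prop :=
  ∀ v : V, ∀ ω ∈ Context G v, K v ω ≤ ρ v

/-- The state space `S = ∏_v [0, ρ v]`. -/
def States (ρ : V → ℕ) : Set (V → ℕ) := {s | ∀ v, s v ≤ ρ v}

/-- `s ∈ ω` : the state `s` lies in the context `ω`. -/
def memCtx (ω : V → ℕ × ℕ) (s : V → ℕ) : Prop :=
  ∀ u, (ω u).1 ≤ s u ∧ s u < (ω u).2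

/-- The (unique) regulatory context of `v` containing the state `s`. -/
noncomputable def ctxOf (G : RegGraph V ρ) (v : V) (s : V → ℕ) : V → ℕ × ℕ :=
  fun u => (sSup {m | m ∈ Theta G u v ∧ m ≤ s u}, sInf {m | m ∈ Theta G u v ∧ s u < m})

/-- The asynchronous update function `F^K_v`. -/
noncomputable def F (G : RegGraph V ρ) (K : Param V) (v : V) (s : V → ℕ) : ℕ :=
  if s v < K v (ctxOf G v s) then s v + 1
  else if s v = K v (ctxOf G v s) then s v
  else s v - 1

/-- The derivative `δ(F^K_v)(s) = F^K_v(s) − s_v` (as an integer). -/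
noncomputable def delta (G : RegGraph V ρ) (K : Param V) (v : V) (s : V → ℕ) : ℤ :=
  (F G K v s : ℤ) - (s v : ℤ)

/-- The asynchronous transition system `T_G(K)`, as the set of transitions. -/
noncomputable def TS (G : RegGraph V ρ) (K : Param V) : Set ((V → ℕ) × (V → ℕ)) :=
  {p | p.1 ∈ States ρ ∧ p.2 ∈ States ρ ∧ p.1 ≠ p.2 ∧
    ∃ v : V, p.2 = Function.update p.1 v (F G K v p.1)}

/-- The synchronous transition system of `(G, K)`. -/
noncomputable def SyncTS (G : RegGraph V ρ) (K : Param V) : Set ((V → ℕ) × (V → ℕ)) :=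
  {p | p.1 ∈ States ρ ∧ p.2 ∈ States ρ ∧ ∀ v : V, p.2 v = F G K v p.1}

/-- A parametrization is canonical iff `j − 1 ≤ K_v(ω) ≤ k` for every context with
`ω_v = [j,k)`. -/
def Canonical (G : RegGraph V ρ) (K : Param V) : Prop :=
  ∀ v : V, ∀ ω ∈ Context G v, (ω v).1 - 1 ≤ K v ω ∧ K v ω ≤ (ω v).2

/-- The canonization of a parametrization. -/
noncomputable def CanP (K : Param V) : Param V := fun v ω =>
  if K v ω + 1 < (ω v).1 then (ω v).1 - 1
  else if (ω v).2 < K v ω then (ω v).2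
  else K v ω

/-- A regulatory graph is complete iff it contains every possible edge. -/
def Complete (G : RegGraph V ρ) : Prop :=
  ∀ u v : V, ∀ n : ℕ, 1 ≤ n → n ≤ ρ u → (u, n, v) ∈ G.E

/-- The finite set of all possible edges for activity levels `ρ`. -/
def allEdges (ρ : V → ℕ) : Finset (V × ℕ × V) :=
  Finset.filter (fun e => 1 ≤ e.2.1 ∧ e.2.1 ≤ ρ e.1)
    (Finset.univ ×ˢ (Finset.Icc 1 (Finset.univ.sup ρ)) ×ˢ Finset.univ)

/-- `n_−`: the largest element of `Θ(u,v)` strictly below `n`. -/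
noncomputable def nminus (G : RegGraph V ρ) (u v : V) (n : ℕ) : ℕ :=
  sSup {m | m ∈ Theta G u v ∧ m < n}

/-- `n_+`: the smallest element of `Θ(u,v)` strictly above `n`. -/
noncomputable def nplus (G : RegGraph V ρ) (u v : V) (n : ℕ) : ℕ :=
  sInf {m | m ∈ Theta G u v ∧ n < m}

/-- The parametrization accompanying the completion by the edge `e = (u, n, v)`:
the two contexts obtained by splitting a context of `G` at `n` both inherit the
original value. (`n_−, n_+` are taken w.r.t. the graph `G` before insertion.) -/
noncomputable def CompParam (G : RegGraph V ρ) (K : Param V) (e : V × ℕ × V) : Param V :=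
  fun w ω =>
    if w = e.2.2 ∧ (ω e.1 = (nminus G e.1 e.2.2 e.2.1, e.2.1) ∨
                    ω e.1 = (e.2.1, nplus G e.1 e.2.2 e.2.1))
    then K e.2.2 (Function.update ω e.1 (nminus G e.1 e.2.2 e.2.1, nplus G e.1 e.2.2 e.2.1))
    else K w ω

/-- One completion step: add the least missing edge (w.r.t. the fixed total
order) and extend the parametrization conservatively; complete graphs are fixed. -/
noncomputable def Comp [LinearOrder (V × ℕ × V)] (P : RegGraph V ρ × Param V) :
    RegGraph V ρ × Param V :=
  if h : ((allEdges ρ) \ P.1.E).Nonempty then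
    (⟨insert (((allEdges ρ) \ P.1.E).min' h) P.1.E, by
        intro e' he'
        rcases Finset.mem_insert.mp he' with h1 | h1
        · have hmem := Finset.min'_mem ((allEdges ρ) \ P.1.E) h
          have hall : ((allEdges ρ) \ P.1.E).min' h ∈ allEdges ρ :=
            (Finset.mem_sdiff.mp hmem).1
          rw [h1]
          exact (Finset.mem_filter.mp hall).2
        · exact P.1.valid e' h1⟩,
      CompParam P.1 P.2 (((allEdges ρ) \ P.1.E).min' h))
  else P

/-- `P` is a fixed point of `f` reached by iterating `f` from `start`. -/
def IsFixReached {α : Type*} (f : α → α) (start P : α) : Prop :=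
  (∃ n : ℕ, f^[n] start = P) ∧ f P = P

/-- Equality of parametrized regulatory graphs: the graphs coincide and the
parametrizations agree on all regulatory contexts. -/
def PGEq (A B : RegGraph V ρ × Param V) : Prop :=
  A.1 = B.1 ∧ ∀ v : V, ∀ ω ∈ Context A.1 v, A.2 v ω = B.2 v ω

/-- Replacing the value of `K` at component `v` and context `ω` by `j'`. -/
noncomputable def replaceAt (K : Param V) (v : V) (ω : V → ℕ × ℕ) (j' : ℕ) : Param V :=
  fun w ω' => if w = v ∧ ω' = ω then j' else K w ω'

/-- The edge `e = (u,n,v)` is not observable in the parametrization `K`. -/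
def NotObsParam (G : RegGraph V ρ) (K : Param V) (e : V × ℕ × V) : Prop :=
  ∀ ω ∈ Context G e.2.2, ω e.1 = (e.2.1, nplus G e.1 e.2.2 e.2.1) →
    K e.2.2 ω = K e.2.2 (Function.update ω e.1 (nminus G e.1 e.2.2 e.2.1, e.2.1))

/-- The edge `e = (u,n,v)` is not observable in the transition system `T_G(K)`. -/
def NotObsTS (G : RegGraph V ρ) (K : Param V) (e : V × ℕ × V) : Prop :=
  ∀ s ∈ States ρ, nminus G e.1 e.2.2 e.2.1 ≤ s e.1 → s e.1 < nplus G e.1 e.2.2 e.2.1 →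
    ∃ k ≤ ρ e.2.2, ∀ j : ℕ, nminus G e.1 e.2.2 e.2.1 ≤ j → j < nplus G e.1 e.2.2 e.2.1 →
      delta G K e.2.2 (Function.update s e.1 j) =
        Int.sign ((k : ℤ) - ((Function.update s e.1 j) e.2.2 : ℤ))

/-- The monotone target value `(F^K_v)^{mon}(s)`. -/
noncomputable def mon (G : RegGraph V ρ) (K : Param V) (v : V) (s : V → ℕ) : ℕ :=
  if delta G K v s = 0 then s v
  else if delta G K v s = 1 then
    sInf {j | s v < j ∧ delta G K v (Function.update s v j) ≠ 1}
  else
    sSup {j | j < s v ∧ delta G K v (Function.update s v j) ≠ -1}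

/-- Non-observability of `e = (u,n,v)` in `T_G(K)` phrased via monotone target values. -/
def NotObsTSmon (G : RegGraph V ρ) (K : Param V) (e : V × ℕ × V) : Prop :=
  ∀ s ∈ States ρ, nminus G e.1 e.2.2 e.2.1 ≤ s e.1 → s e.1 < nplus G e.1 e.2.2 e.2.1 →
    ∀ j : ℕ, nminus G e.1 e.2.2 e.2.1 ≤ j → j < nplus G e.1 e.2.2 e.2.1 →
      delta G K e.2.2 (Function.update s e.1 j) =
        Int.sign ((mon G K e.2.2 s : ℤ) - ((Function.update s e.1 j) e.2.2 : ℤ))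

/-- In the normalization algorithm: the context below the current one
(the `v`-interval is replaced by its predecessor interval `[n_{i−1}, n_i)`). -/
noncomputable def updLow (G : RegGraph V ρ) (v : V) (ω : V → ℕ × ℕ) : V → ℕ × ℕ :=
  Function.update ω v (sSup {m | m ∈ Theta G v v ∧ m < (ω v).1}, (ω v).1)

/-- In the normalization algorithm: the context above the current one
(the `v`-interval is replaced by its successor interval `[n_{i+1}, n_{i+2})`). -/
noncomputable def updHigh (G : RegGraph V ρ) (v : V) (ω : V → ℕ × ℕ) : V → ℕ × ℕ :=
  Function.update ω v ((ω v).2, sInf {m | m ∈ Theta G v v ∧ (ω v).2 < m})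

/-- The recursive normalization algorithm `Norm(K, v, ω)` of the paper, as an
inductive big-step relation: `NormRel G K v ω r` holds iff the recursion
started at `ω` terminates with result `r`. -/
inductive NormRel (G : RegGraph V ρ) (K : Param V) (v : V) : (V → ℕ × ℕ) → ℕ → Prop
  | inside (ω : V → ℕ × ℕ) (h1 : (ω v).1 ≤ K v ω) (h2 : K v ω < (ω v).2) :
      NormRel G K v ω (K v ω)
  | belowStop (ω : V → ℕ × ℕ) (h : K v ω < (ω v).1)
      (h2 : (ω v).1 - 1 ≤ K v (updLow G v ω)) :
      NormRel G K v ω ((ω v).1 - 1)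
  | belowRec (ω : V → ℕ × ℕ) (r : ℕ) (h : K v ω < (ω v).1)
      (h2 : K v (updLow G v ω) < (ω v).1 - 1)
      (hrec : NormRel G K v (updLow G v ω) r) :
      NormRel G K v ω r
  | aboveStop (ω : V → ℕ × ℕ) (h : (ω v).2 ≤ K v ω)
      (h2 : K v (updHigh G v ω) ≤ (ω v).2) :
      NormRel G K v ω ((ω v).2)
  | aboveRec (ω : V → ℕ × ℕ) (r : ℕ) (h : (ω v).2 ≤ K v ω)
      (h2 : (ω v).2 < K v (updHigh G v ω))
      (hrec : NormRel G K v (updHigh G v ω) r) :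
      NormRel G K v ω r

/-- The normalized parametrization: each context gets the common monotone
target value of its states (represented by the lower corner of the context). -/
noncomputable def NormPm (G : RegGraph V ρ) (K : Param V) : Param V :=
  fun v ω => mon G K v (fun u => (ω u).1)

/-- The edges of `G` that are not observable in `N`. -/
noncomputable def nonObsEdges (G : RegGraph V ρ) (N : Param V) : Finset (V × ℕ × V) :=
  G.E.filter (fun e => NotObsParam G N e)

/-- The parametrization accompanying the removal of the non-observable edge
`e = (u,n,v)`: the two contexts merged into one pass on their common value. -/
noncomputable def MinParam (G : RegGraph V ρ) (N : Param V) (e : V × ℕ × V) : Param V :=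
  fun w ω =>
    if w = e.2.2 ∧ ω e.1 = (nminus G e.1 e.2.2 e.2.1, nplus G e.1 e.2.2 e.2.1)
    then N e.2.2 (Function.update ω e.1 (nminus G e.1 e.2.2 e.2.1, e.2.1))
    else N w ω

/-- One minimization step: remove the least edge (w.r.t. the fixed total order)
that is not observable in `N`; if all edges are observable, do nothing. -/
noncomputable def Minim [LinearOrder (V × ℕ × V)] (P : RegGraph V ρ × Param V) :
    RegGraph V ρ × Param V :=
  if h : (nonObsEdges P.1 P.2).Nonempty then
    (⟨P.1.E.erase ((nonObsEdges P.1 P.2).min' h),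
        fun e' he' => P.1.valid e' (Finset.mem_of_mem_erase he')⟩,
      MinParam P.1 P.2 ((nonObsEdges P.1 P.2).min' h))
  else P



theorem Theta_le (G : RegGraph V ρ) {u v : V} {m : ℕ} (h : m ∈ Theta G u v) : m ≤ ρ u + 1 := by
  rcases h with h | h
  · have := (G.valid _ h).2
    simp at this
    omega
  · simp at h
    omega

theorem delta_one_iff (G : RegGraph V ρ) (K : Param V) (v : V) (s : V → ℕ) :
    delta G K v s = 1 ↔ s v < K v (ctxOf G v s) := by
  unfold delta F
  split_ifs <;> omega

theorem delta_zero_iff (G : RegGraph V ρ) (K : Param V) (v : V) (s : V → ℕ) :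
    delta G K v s = 0 ↔ s v = K v (ctxOf G v s) := by
  unfold delta F
  split_ifs <;> omega

theorem delta_neg_iff (G : RegGraph V ρ) (K : Param V) (v : V) (s : V → ℕ) :
    delta G K v s = -1 ↔ K v (ctxOf G v s) < s v := by
  unfold delta F
  split_ifs <;> omega

theorem ctxOf_eq (G : RegGraph V ρ) {v : V} {ω : V → ℕ × ℕ} (hω : ω ∈ Context G v)
    {s : V → ℕ} (hs : memCtx ω s) : ctxOf G v s = ω := by
  funext u
  obtain ⟨h1, h2, h3, h4⟩ := hω u
  obtain ⟨a, b⟩ := hs u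
  have e1 : IsGreatest {m | m ∈ Theta G u v ∧ m ≤ s u} (ω u).1 := by
    refine ⟨⟨h1, a⟩, ?_⟩
    rintro m ⟨hm, hm2⟩
    have := h4 m hm
    omega
  have e2 : IsLeast {m | m ∈ Theta G u v ∧ s u < m} (ω u).2 := by
    refine ⟨⟨h2, b⟩, ?_⟩
    rintro m ⟨hm, hm2⟩
    have := h4 m hm
    omega
  unfold ctxOf
  rw [e1.csSup_eq, e2.csInf_eq]

theorem updHigh_mem (G : RegGraph V ρ) {v : V} {ω : V → ℕ × ℕ} (hω : ω ∈ Context G v)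
    (h : (ω v).2 ≤ ρ v) :
    updHigh G v ω ∈ Context G v ∧ (updHigh G v ω v).1 = (ω v).2 ∧
      (ω v).2 < (updHigh G v ω v).2 ∧ (updHigh G v ω v).2 ≤ ρ v + 1 := by
  have hne : {m | m ∈ Theta G v v ∧ (ω v).2 < m}.Nonempty :=
    ⟨ρ v + 1, Or.inr (by simp), by omega⟩
  have hm := Nat.sInf_mem hne
  refine ⟨?_, by simp [updHigh], by simpa [updHigh] using hm.2,
    by simpa [updHigh] using Theta_le G hm.1⟩
  intro u
  by_cases hu : u = v
  · subst hu
    simp only [updHigh, Function.update_self]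
    refine ⟨(hω u).2.1, hm.1, hm.2, ?_⟩
    rintro l hl ⟨h1, h2⟩
    have := Nat.sInf_le (show l ∈ {m | m ∈ Theta G u u ∧ (ω u).2 < m} from ⟨hl, h1⟩)
    exact absurd h2 (by simpa using this)
  · simp only [updHigh, Function.update_of_ne hu]
    exact hω u

theorem updLow_mem (G : RegGraph V ρ) {v : V} {ω : V → ℕ × ℕ} (hω : ω ∈ Context G v)
    (h : 0 < (ω v).1) :
    updLow G v ω ∈ Context G v ∧ (updLow G v ω v).2 = (ω v).1 ∧
      (updLow G v ω v).1 < (ω v).1 := by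
  have hne : {m | m ∈ Theta G v v ∧ m < (ω v).1}.Nonempty :=
    ⟨0, Or.inr (by simp), by omega⟩
  have hb : BddAbove {m | m ∈ Theta G v v ∧ m < (ω v).1} := ⟨(ω v).1, fun m hm => hm.2.le⟩
  have hm := Nat.sSup_mem hne hb
  refine ⟨?_, by simp [updLow], by simpa [updLow] using hm.2⟩
  intro u
  by_cases hu : u = v
  · subst hu
    simp only [updLow, Function.update_self]
    refine ⟨hm.1, (hω u).1, hm.2, ?_⟩
    rintro l hl ⟨h1, h2⟩
    have := le_csSup hb (show l ∈ {m | m ∈ Theta G u u ∧ m < (ω u).1} from ⟨hl, h2⟩)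
    exact absurd h1 (by simpa using this)
  · simp only [updLow, Function.update_of_ne hu]
    exact hω u

theorem memCtx_update {ω : V → ℕ × ℕ} {v : V} {s : V → ℕ} (hs : memCtx ω s) {j : ℕ}
    {p : ℕ × ℕ} (h1 : p.1 ≤ j) (h2 : j < p.2) :
    memCtx (Function.update ω v p) (Function.update s v j) := by
  intro u
  by_cases hu : u = v
  · subst hu
    simp [h1, h2]
  · simpa [Function.update_of_ne hu] using hs u

theorem ctx_same (G : RegGraph V ρ) {ω : V → ℕ × ℕ} {v : V} (hω : ω ∈ Context G v)
    {s : V → ℕ} (hs : memCtx ω s) {j : ℕ} (h1 : (ω v).1 ≤ j) (h2 : j < (ω v).2) :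
    ctxOf G v (Function.update s v j) = ω := by
  refine ctxOf_eq G hω ?_
  have := memCtx_update (v := v) hs h1 h2
  rwa [Function.update_eq_self] at this

theorem mem_high (G : RegGraph V ρ) {ω : V → ℕ × ℕ} {v : V} (hω : ω ∈ Context G v)
    (h : (ω v).2 ≤ ρ v) {s : V → ℕ} (hs : memCtx ω s) :
    memCtx (updHigh G v ω) (Function.update s v (ω v).2) := by
  have := (updHigh_mem G hω h).2.2.1
  simp only [updHigh, Function.update_self] at this
  exact memCtx_update hs le_rfl this

theorem mem_low (G : RegGraph V ρ) {ω : V → ℕ × ℕ} {v : V} (hω : ω ∈ Context G v)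
    (h : 0 < (ω v).1) {s : V → ℕ} (hs : memCtx ω s) :
    memCtx (updLow G v ω) (Function.update s v ((ω v).1 - 1)) := by
  have := (updLow_mem G hω h).2.2
  simp only [updLow, Function.update_self] at this
  exact memCtx_update hs (show _ ≤ _ by simp only; omega) (show _ < _ by simp only; omega)

theorem exists_up (G : RegGraph V ρ) (K : Param V) (hK : IsParam G K) (v : V) :
    ∀ n : ℕ, ∀ ω ∈ Context G v, ρ v + 1 - (ω v).2 ≤ n → (ω v).1 ≤ K v ω →
      ∃ r, NormRel G K v ω r := by
  intro n
  induction n with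
  | zero =>
    intro ω hω hn h
    have := hK v ω hω
    exact ⟨_, .inside ω h (by omega)⟩
  | succ n ih =>
    intro ω hω hn h
    have hk := hK v ω hω
    by_cases h1 : K v ω < (ω v).2
    · exact ⟨_, .inside ω h h1⟩
    · push Not at h1
      obtain ⟨a, b, c, d⟩ := updHigh_mem G hω (h1.trans hk)
      by_cases h2 : K v (updHigh G v ω) ≤ (ω v).2
      · exact ⟨_, .aboveStop ω h1 h2⟩
      · obtain ⟨r, hr⟩ := ih _ a (by omega) (by omega)
        exact ⟨r, .aboveRec ω r h1 (by omega) hr⟩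

theorem exists_down (G : RegGraph V ρ) (K : Param V) (v : V) :
    ∀ n : ℕ, ∀ ω ∈ Context G v, (ω v).1 ≤ n → K v ω < (ω v).2 →
      ∃ r, NormRel G K v ω r := by
  intro n
  induction n with
  | zero =>
    intro ω hω hn h
    exact ⟨_, .inside ω (by omega) h⟩
  | succ n ih =>
    intro ω hω hn h
    by_cases h1 : (ω v).1 ≤ K v ω
    · exact ⟨_, .inside ω h1 h⟩
    · push Not at h1
      obtain ⟨a, b, c⟩ := updLow_mem G hω (by omega)
      by_cases h2 : (ω v).1 - 1 ≤ K v (updLow G v ω)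
      · exact ⟨_, .belowStop ω h1 h2⟩
      · obtain ⟨r, hr⟩ := ih _ a (by omega) (by omega)
        exact ⟨r, .belowRec ω r h1 (by omega) hr⟩

theorem mon_up (G : RegGraph V ρ) (K : Param V) (v : V) (s : V → ℕ) (r : ℕ) (hr : s v < r)
    (h1 : ∀ j, s v ≤ j → j < r → delta G K v (Function.update s v j) = 1)
    (h2 : delta G K v (Function.update s v r) ≠ 1) : mon G K v s = r := by
  have h0 := h1 (s v) le_rfl hr
  rw [Function.update_eq_self] at h0
  unfold mon
  rw [if_neg (by omega), if_pos h0]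
  refine IsLeast.csInf_eq ⟨⟨hr, h2⟩, ?_⟩
  rintro j ⟨hj, hj2⟩
  by_contra hc
  exact hj2 (h1 j hj.le (by omega))

theorem mon_down (G : RegGraph V ρ) (K : Param V) (v : V) (s : V → ℕ) (r : ℕ) (hr : r < s v)
    (h1 : ∀ j, j ≤ s v → r < j → delta G K v (Function.update s v j) = -1)
    (h2 : delta G K v (Function.update s v r) ≠ -1) : mon G K v s = r := by
  have h0 := h1 (s v) le_rfl hr
  rw [Function.update_eq_self] at h0
  unfold mon
  rw [if_neg (by omega), if_neg (by omega)]
  refine IsGreatest.csSup_eq ⟨⟨hr, h2⟩, ?_⟩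
  rintro j ⟨hj, hj2⟩
  by_contra hc
  exact hj2 (h1 j hj.le (by omega))

theorem mon_step_up (G : RegGraph V ρ) (K : Param V) (v : V) (s : V → ℕ) (r : ℕ) (hr : s v < r)
    (h1 : ∀ j, s v ≤ j → j ≤ r → delta G K v (Function.update s v j) = 1) :
    mon G K v (Function.update s v r) = mon G K v s := by
  have h0 := h1 (s v) le_rfl hr.le
  have h2 := h1 r hr.le le_rfl
  rw [Function.update_eq_self] at h0
  unfold mon
  rw [if_neg (by omega), if_pos h2, if_neg (by omega), if_pos h0]
  congr 1
  ext j
  simp only [Function.update_self, Function.update_idem, Set.mem_setOf_eq]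
  constructor
  · rintro ⟨a, b⟩
    exact ⟨by omega, b⟩
  · rintro ⟨a, b⟩
    refine ⟨?_, b⟩
    by_contra hc
    exact b (h1 j a.le (by omega))

theorem mon_step_down (G : RegGraph V ρ) (K : Param V) (v : V) (s : V → ℕ) (r : ℕ) (hr : r < s v)
    (h1 : ∀ j, j ≤ s v → r ≤ j → delta G K v (Function.update s v j) = -1) :
    mon G K v (Function.update s v r) = mon G K v s := by
  have h0 := h1 (s v) le_rfl hr.le
  have h2 := h1 r hr.le le_rfl
  rw [Function.update_eq_self] at h0
  unfold mon
  rw [if_neg (by omega), if_neg (by omega), if_neg (by omega), if_neg (by omega)]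
  congr 1
  ext j
  simp only [Function.update_self, Function.update_idem, Set.mem_setOf_eq]
  constructor
  · rintro ⟨a, b⟩
    exact ⟨by omega, b⟩
  · rintro ⟨a, b⟩
    refine ⟨?_, b⟩
    by_contra hc
    exact b (h1 j a.le (by omega))

theorem norm_eq_mon (G : RegGraph V ρ) (K : Param V) (hK : IsParam G K) (v : V)
    (ω : V → ℕ × ℕ) (r : ℕ) (h : NormRel G K v ω r) :
    ω ∈ Context G v → ∀ s, memCtx ω s → r = mon G K v s := by
  induction h with
  | inside ω h1 h2 =>
    intro hω s hs
    have hv := hs v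
    symm
    rcases lt_trichotomy (s v) (K v ω) with h | h | h
    · refine mon_up G K v s _ h ?_ ?_
      · intro j a b
        rw [delta_one_iff, ctx_same G hω hs (by omega) (by omega), Function.update_self]
        omega
      · rw [Ne, delta_one_iff, ctx_same G hω hs (by omega) (by omega), Function.update_self]
        omega
    · have : delta G K v s = 0 := by
        rw [delta_zero_iff, ctxOf_eq G hω hs, h]
      unfold mon
      rw [if_pos this, h]
    · refine mon_down G K v s _ h ?_ ?_
      · intro j a b
        rw [delta_neg_iff, ctx_same G hω hs (by omega) (by omega), Function.update_self]
        omega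
      · rw [Ne, delta_neg_iff, ctx_same G hω hs (by omega) (by omega), Function.update_self]
        omega
  | belowStop ω h h2 =>
    intro hω s hs
    have hv := hs v
    have hl := updLow_mem G hω (by omega)
    symm
    refine mon_down G K v s _ (by omega) ?_ ?_
    · intro j a b
      rw [delta_neg_iff, ctx_same G hω hs (by omega) (by omega), Function.update_self]
      omega
    · rw [Ne, delta_neg_iff, ctxOf_eq G hl.1 (mem_low G hω (by omega) hs), Function.update_self]
      omega
  | belowRec ω r h h2 hrec ih =>
    intro hω s hs
    have hv := hs v
    have hl := updLow_mem G hω (by omega)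
    have hm := mem_low G hω (by omega) hs
    rw [ih hl.1 _ hm]
    refine mon_step_down G K v s _ (by omega) ?_
    intro j a b
    rcases b.eq_or_lt with b | b
    · subst b
      rw [delta_neg_iff, ctxOf_eq G hl.1 hm, Function.update_self]
      omega
    · rw [delta_neg_iff, ctx_same G hω hs (by omega) (by omega), Function.update_self]
      omega
  | aboveStop ω h h2 =>
    intro hω s hs
    have hv := hs v
    have hk := h.trans (hK v ω hω)
    have hl := updHigh_mem G hω hk
    symm
    refine mon_up G K v s _ (by omega) ?_ ?_
    · intro j a b
      rw [delta_one_iff, ctx_same G hω hs (by omega) (by omega), Function.update_self]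
      omega
    · rw [Ne, delta_one_iff, ctxOf_eq G hl.1 (mem_high G hω hk hs), Function.update_self]
      omega
  | aboveRec ω r h h2 hrec ih =>
    intro hω s hs
    have hv := hs v
    have hk := h.trans (hK v ω hω)
    have hl := updHigh_mem G hω hk
    have hm := mem_high G hω hk hs
    rw [ih hl.1 _ hm]
    refine mon_step_up G K v s _ (by omega) ?_
    intro j a b
    rcases b.eq_or_lt with b | b
    · subst b
      rw [delta_one_iff, ctxOf_eq G hl.1 hm, Function.update_self]
      omega
    · rw [delta_one_iff, ctx_same G hω hs (by omega) (by omega), Function.update_self]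
      omega

/-- The normalization algorithm terminates on every regulatory
context and computes the common monotone target value of the states of the
context. -/
theorem normalization_correct {V : Type*} [DecidableEq V] [Fintype V]
    {ρ : V → ℕ} (hρ : ∀ v, 1 ≤ ρ v) (G : RegGraph V ρ)
    (K : Param V) (hK : IsParam G K) :
    ∀ v : V, ∀ ω ∈ Context G v,
      (∃ r : ℕ, NormRel G K v ω r) ∧
      (∀ r : ℕ, NormRel G K v ω r →
        ∀ s ∈ States ρ, memCtx ω s → r = mon G K v s) := by
  intro v ω hω
  refine ⟨?_, fun r hr s _ hs => norm_eq_mon G K hK v ω r hr hω s hs⟩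
  by_cases h : K v ω < (ω v).2
  · exact exists_down G K v _ ω hω le_rfl h
  · have := (hω v).2.2.1
    exact exists_up G K hK v _ ω hω le_rfl (by omega)

end MVReg
end

section
/- Normalization is conservative: for every multi-valued regulatory graph G and every parametrization K ∈ K_G, if Norm(G,K)=(G,N) — i.e., N_v(ω)=Norm(K,v,ω) for all v∈V and ω∈Ω_v — then T_G(K) = T_G(N). -/
/-!
Formalization of multi-valued regulatory graphs (Thomas networks),
their parametrizations, asynchronous transition systems,
canonization, completion, normalization and minimization.
-/

namespace MVReg

open Classical

variable {V : Type*} [DecidableEq V] [Fintype V] {ρ : V → ℕ}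

theorem aux_sup (T : Set ℕ) (P : ℕ → Prop) (n : ℕ) (h0 : 0 ∈ T) (hP : P 0)
    (hb : ∀ m, P m → m ≤ n) :
    sSup {m | m ∈ T ∧ P m} ∈ T ∧ P (sSup {m | m ∈ T ∧ P m}) ∧
      ∀ m ∈ T, P m → m ≤ sSup {m | m ∈ T ∧ P m} := by
  have hbd : BddAbove {m | m ∈ T ∧ P m} := ⟨n, fun m hm => hb m hm.2⟩
  have h := Nat.sSup_mem (s := {m | m ∈ T ∧ P m}) ⟨0, h0, hP⟩ hbd
  exact ⟨h.1, h.2, fun m hm hp => le_csSup hbd ⟨hm, hp⟩⟩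

theorem aux_inf (T : Set ℕ) (P : ℕ → Prop) (n : ℕ) (h0 : n ∈ T) (hP : P n) :
    sInf {m | m ∈ T ∧ P m} ∈ T ∧ P (sInf {m | m ∈ T ∧ P m}) ∧
      ∀ m ∈ T, P m → sInf {m | m ∈ T ∧ P m} ≤ m := by
  have h := Nat.sInf_mem (s := {m | m ∈ T ∧ P m}) ⟨n, h0, hP⟩
  exact ⟨h.1, h.2, fun m hm hp => Nat.sInf_le ⟨hm, hp⟩⟩

theorem aux_zero {V : Type*} {ρ : V → ℕ} (G : RegGraph V ρ) (u v : V) :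
    0 ∈ Theta G u v := by simp [Theta]

theorem aux_top {V : Type*} {ρ : V → ℕ} (G : RegGraph V ρ) (u v : V) :
    ρ u + 1 ∈ Theta G u v := by simp [Theta]

theorem aux_ctxOf {V : Type*} {ρ : V → ℕ} (G : RegGraph V ρ) (v : V) (s : V → ℕ)
    (hs : s ∈ States ρ) : ctxOf G v s ∈ Context G v ∧ memCtx (ctxOf G v s) s := by
  have key : ∀ u, ctxOf G v s u ∈ ActInterval G u v ∧
      ((ctxOf G v s u).1 ≤ s u ∧ s u < (ctxOf G v s u).2) := by
    intro u
    obtain ⟨a1, a2, a3⟩ := aux_sup (Theta G u v) (fun m => m ≤ s u) (s u) (aux_zero G u v)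
      (Nat.zero_le _) (fun m h => h)
    obtain ⟨b1, b2, b3⟩ := aux_inf (Theta G u v) (fun m => s u < m) (ρ u + 1) (aux_top G u v)
      (Nat.lt_succ_of_le (hs u))
    refine ⟨⟨a1, b1, lt_of_le_of_lt a2 b2, ?_⟩, a2, b2⟩
    rintro l hl ⟨h1, h2⟩
    rcases le_or_gt l (s u) with h | h
    · exact absurd (a3 l hl h) (not_le.mpr h1)
    · exact absurd (b3 l hl h) (not_le.mpr h2)
  exact ⟨fun u => (key u).1, fun u => (key u).2⟩

theorem aux_low {V : Type*} [DecidableEq V] {ρ : V → ℕ} (G : RegGraph V ρ) (v : V)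
    (ω : V → ℕ × ℕ) (hω : ω ∈ Context G v) (hj : 0 < (ω v).1) :
    updLow G v ω ∈ Context G v ∧ (updLow G v ω v).1 < (ω v).1 ∧
      (updLow G v ω v).2 = (ω v).1 := by
  obtain ⟨a1, a2, a3⟩ := aux_sup (Theta G v v) (fun m => m < (ω v).1) (ω v).1 (aux_zero G v v)
    hj (fun m h => le_of_lt h)
  refine ⟨?_, by simpa [updLow] using a2, by simp [updLow]⟩
  intro u
  by_cases hu : u = v
  · subst hu
    simp only [updLow, Function.update_self]
    exact ⟨a1, (hω u).1, a2, fun l hl h => absurd (a3 l hl h.2) (not_le.mpr h.1)⟩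
  · simp only [updLow, Function.update_of_ne hu]
    exact hω u

theorem aux_high {V : Type*} [DecidableEq V] {ρ : V → ℕ} (G : RegGraph V ρ) (v : V)
    (ω : V → ℕ × ℕ) (hω : ω ∈ Context G v) (hj : (ω v).2 < ρ v + 1) :
    updHigh G v ω ∈ Context G v ∧ (updHigh G v ω v).1 = (ω v).2 ∧
      (ω v).2 < (updHigh G v ω v).2 := by
  obtain ⟨a1, a2, a3⟩ := aux_inf (Theta G v v) (fun m => (ω v).2 < m) (ρ v + 1) (aux_top G v v)
    hj
  refine ⟨?_, by simp [updHigh], by simpa [updHigh] using a2⟩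
  intro u
  by_cases hu : u = v
  · subst hu
    simp only [updHigh, Function.update_self]
    exact ⟨(hω u).2.1, a1, a2, fun l hl h => absurd (a3 l hl h.1) (not_le.mpr h.2)⟩
  · simp only [updHigh, Function.update_of_ne hu]
    exact hω u

theorem aux_norm {V : Type*} [DecidableEq V] {ρ : V → ℕ} (G : RegGraph V ρ)
    (K : Param V) (hK : IsParam G K) (v : V) (ω : V → ℕ × ℕ) (r : ℕ)
    (h : NormRel G K v ω r) (hω : ω ∈ Context G v) :
    (K v ω < (ω v).1 → r < (ω v).1) ∧ ((ω v).2 ≤ K v ω → (ω v).2 ≤ r) ∧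
      ((ω v).1 ≤ K v ω → K v ω < (ω v).2 → r = K v ω) := by
  induction h with
  | inside ω h1 h2 => omega
  | belowStop ω h h2 =>
    have := (hω v).2.2.1
    omega
  | belowRec ω r h h2 hrec ih =>
    have := (hω v).2.2.1
    obtain ⟨c, c1, c2⟩ := aux_low G v ω hω (by omega)
    have := ih c
    omega
  | aboveStop ω h h2 =>
    have := (hω v).2.2.1
    omega
  | aboveRec ω r h h2 hrec ih =>
    have := (hω v).2.2.1
    have := hK v ω hω
    obtain ⟨c, c1, c2⟩ := aux_high G v ω hω (by omega)
    have := ih c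
    omega

/-- Normalization is conservative: if `N` is obtained from `K`
by the normalization algorithm on every context, then `T_G(K) = T_G(N)`. -/
theorem normalization_conservative {V : Type*} [DecidableEq V] [Fintype V]
    {ρ : V → ℕ} (hρ : ∀ v, 1 ≤ ρ v) (G : RegGraph V ρ)
    (K : Param V) (hK : IsParam G K)
    (N : Param V) (hN : ∀ v : V, ∀ ω ∈ Context G v, NormRel G K v ω (N v ω)) :
    TS G K = TS G N := by
  have key : ∀ v : V, ∀ s ∈ States ρ, F G K v s = F G N v s := by
    intro v s hs
    obtain ⟨hc, hm⟩ := aux_ctxOf G v s hs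
    have h := aux_norm G K hK v _ _ (hN v _ hc) hc
    have h2 := hm v
    unfold F
    split_ifs <;> omega
  ext p
  constructor
  · rintro ⟨h1, h2, h3, v, h4⟩
    exact ⟨h1, h2, h3, v, by rw [← key v _ h1]; exact h4⟩
  · rintro ⟨h1, h2, h3, v, h4⟩
    exact ⟨h1, h2, h3, v, by rw [key v _ h1]; exact h4⟩

end MVReg
end

section
/- For every multi-valued regulatory graph G, every parametrization K ∈ K_G and Norm(G,K)=(G,N), the recursive sequence Min(G,N), Min(Min(G,N)), … becomes constant after finitely many steps at a fixed point (G^m,N^m), and G^m is minimal: there is no parametrized regulatory graph (G',K') with T_{G'}(K') = T_G(K) such that G' has fewer edges than G^m. -/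
/-!
Formalization of multi-valued regulatory graphs (Thomas networks),
their parametrizations, asynchronous transition systems,
canonization, completion, normalization and minimization.
-/

namespace MVReg

open Classical

variable {V : Type*} [DecidableEq V] [Fintype V] {ρ : V → ℕ}

/-! ### Helper lemmas -/

theorem aux_theta_zero (G : RegGraph V ρ) (u v : V) : 0 ∈ Theta G u v := by
  simp [Theta]

theorem aux_theta_top (G : RegGraph V ρ) (u v : V) : ρ u + 1 ∈ Theta G u v := by
  simp [Theta]

theorem aux_theta_le (G : RegGraph V ρ) (u v : V) {m : ℕ} (h : m ∈ Theta G u v) :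
    m ≤ ρ u + 1 := by
  simp only [Theta, Set.mem_union, Set.mem_setOf_eq, Set.mem_insert_iff,
    Set.mem_singleton_iff] at h
  rcases h with h | h | h
  · have := (G.valid _ h).2
    simp only at this
    omega
  · omega
  · omega

theorem aux_ctx_spec (G : RegGraph V ρ) (v : V) (s : V → ℕ) (u : V) (hs : s u ≤ ρ u) :
    ctxOf G v s u ∈ ActInterval G u v ∧ (ctxOf G v s u).1 ≤ s u ∧ s u < (ctxOf G v s u).2 := by
  have h1 : sSup {m | m ∈ Theta G u v ∧ m ≤ s u} ∈ {m | m ∈ Theta G u v ∧ m ≤ s u} :=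
    Nat.sSup_mem ⟨0, aux_theta_zero G u v, Nat.zero_le _⟩ ⟨s u, fun x hx => hx.2⟩
  have h2 : sInf {m | m ∈ Theta G u v ∧ s u < m} ∈ {m | m ∈ Theta G u v ∧ s u < m} :=
    Nat.sInf_mem ⟨ρ u + 1, aux_theta_top G u v, by omega⟩
  refine ⟨⟨h1.1, h2.1, lt_of_le_of_lt h1.2 h2.2, ?_⟩, h1.2, h2.2⟩
  rintro l hl ⟨hl1, hl2⟩
  by_cases hc : l ≤ s u
  · have : l ≤ sSup {m | m ∈ Theta G u v ∧ m ≤ s u} :=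
      le_csSup ⟨s u, fun x hx => hx.2⟩ ⟨hl, hc⟩
    simp only [ctxOf] at hl1
    omega
  · have : sInf {m | m ∈ Theta G u v ∧ s u < m} ≤ l := Nat.sInf_le ⟨hl, by omega⟩
    simp only [ctxOf] at hl2
    omega

theorem aux_act_unique (G : RegGraph V ρ) (u v : V) {p q : ℕ × ℕ} {x : ℕ}
    (hp : p ∈ ActInterval G u v) (hq : q ∈ ActInterval G u v)
    (hp1 : p.1 ≤ x) (hp2 : x < p.2) (hq1 : q.1 ≤ x) (hq2 : x < q.2) : p = q := by
  obtain ⟨a, b⟩ := p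
  obtain ⟨c, d⟩ := q
  obtain ⟨ha, hb, hab, hn⟩ := hp
  obtain ⟨hc, hd, hcd, hm⟩ := hq
  simp only at *
  have h1 := hn c hc
  have h2 := hn d hd
  have h3 := hm a ha
  have h4 := hm b hb
  ext <;> simp only <;> omega

theorem aux_ctx_eq (G : RegGraph V ρ) (v : V) (s : V → ℕ) (u : V) {p : ℕ × ℕ}
    (hp : p ∈ ActInterval G u v) (h1 : p.1 ≤ s u) (h2 : s u < p.2) : ctxOf G v s u = p := by
  have hs : s u ≤ ρ u := by
    have := aux_theta_le G u v hp.2.1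
    omega
  obtain ⟨h3, h4, h5⟩ := aux_ctx_spec G v s u hs
  exact aux_act_unique G u v h3 hp h4 h5 h1 h2

theorem aux_ctx_mem (G : RegGraph V ρ) (v : V) (s : V → ℕ) (hs : s ∈ States ρ) :
    ctxOf G v s ∈ Context G v := fun u => (aux_ctx_spec G v s u (hs u)).1

theorem aux_ctx_congr (G : RegGraph V ρ) (v : V) (s t : V → ℕ) (u : V) (h : s u = t u) :
    ctxOf G v s u = ctxOf G v t u := by
  simp [ctxOf, h]

theorem aux_delta_lt {G : RegGraph V ρ} {K : Param V} {v : V} {s : V → ℕ} :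
    delta G K v s = 1 ↔ s v < K v (ctxOf G v s) := by
  unfold delta F
  split_ifs <;> omega

theorem aux_delta_eq {G : RegGraph V ρ} {K : Param V} {v : V} {s : V → ℕ} :
    delta G K v s = 0 ↔ s v = K v (ctxOf G v s) := by
  unfold delta F
  split_ifs <;> omega

theorem aux_delta_gt {G : RegGraph V ρ} {K : Param V} {v : V} {s : V → ℕ} :
    delta G K v s = -1 ↔ K v (ctxOf G v s) < s v := by
  unfold delta F
  split_ifs <;> omega

/-- abstract one-dimensional target -/
noncomputable def auxTarget (c : ℕ → ℕ) (x : ℕ) : ℕ :=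
  if x = c x then x
  else if x < c x then sInf {j | x < j ∧ ¬ j < c j}
  else sSup {j | j < x ∧ ¬ c j < j}

theorem aux_mon_eq (G : RegGraph V ρ) (K : Param V) (v : V) (s : V → ℕ) :
    mon G K v s = auxTarget (fun j => K v (ctxOf G v (Function.update s v j))) (s v) := by
  unfold mon auxTarget
  simp only [ne_eq, aux_delta_lt, aux_delta_eq, aux_delta_gt, Function.update_self,
    Function.update_eq_self]

theorem aux_sSup_eq {S : Set ℕ} {k : ℕ} (h : k ∈ S) (h2 : ∀ j ∈ S, j ≤ k) : sSup S = k :=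
  IsGreatest.csSup_eq ⟨h, h2⟩

theorem aux_sInf_eq {S : Set ℕ} {k : ℕ} (h : k ∈ S) (h2 : ∀ j ∈ S, k ≤ j) : sInf S = k :=
  IsLeast.csInf_eq ⟨h, h2⟩

theorem aux_target_const (c : ℕ → ℕ) {x y k : ℕ} (hxy : x ≤ y)
    (hc : ∀ z, x ≤ z → z ≤ y → c z = k) : auxTarget c x = auxTarget c y := by
  rcases Nat.eq_or_lt_of_le hxy with rfl | hlt
  · rfl
  have hx := hc x le_rfl hxy
  have hy := hc y hxy le_rfl
  unfold auxTarget
  rw [hx, hy]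
  rcases lt_trichotomy k x with h | h | h
  · rw [if_neg (by omega), if_neg (by omega), if_neg (by omega), if_neg (by omega)]
    congr 1
    ext j
    simp only [Set.mem_setOf_eq]
    have := hc j
    constructor
    · rintro ⟨h1, h2⟩; exact ⟨by omega, h2⟩
    · rintro ⟨h1, h2⟩
      refine ⟨?_, h2⟩
      by_contra h3
      have := this (by omega) (by omega)
      omega
  · rw [if_pos (by omega), if_neg (by omega), if_neg (by omega)]
    symm
    apply aux_sSup_eq
    · exact ⟨hlt, by omega⟩
    · rintro j ⟨h1, h2⟩
      by_contra h3
      have := hc j (by omega) (by omega)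
      omega
  · rw [if_neg (by omega), if_pos h]
    rcases lt_trichotomy k y with h' | h' | h'
    · rw [if_neg (by omega), if_neg (by omega)]
      have hk := hc k (by omega) (by omega)
      rw [aux_sInf_eq (k := k), aux_sSup_eq (k := k)]
      · exact ⟨h', by omega⟩
      · rintro j ⟨h1, h2⟩
        by_contra h3
        have := hc j (by omega) (by omega)
        omega
      · exact ⟨h, by omega⟩
      · rintro j ⟨h1, h2⟩
        by_contra h3
        have := hc j (by omega) (by omega)
        omega
    · rw [if_pos (by omega)]
      apply aux_sInf_eq
      · exact ⟨hlt, by omega⟩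
      · rintro j ⟨h1, h2⟩
        by_contra h3
        have := hc j (by omega) (by omega)
        omega
    · rw [if_neg (by omega), if_pos (by omega)]
      congr 1
      ext j
      simp only [Set.mem_setOf_eq]
      have := hc j
      constructor
      · rintro ⟨h1, h2⟩
        refine ⟨?_, h2⟩
        by_contra h3
        have := this (by omega) (by omega)
        omega
      · rintro ⟨h1, h2⟩; exact ⟨by omega, h2⟩

theorem aux_mon_const_le (G : RegGraph V ρ) (K : Param V) (v : V) (s t : V → ℕ)
    (hs : s ∈ States ρ) (ht : t ∈ States ρ) (h : ctxOf G v s = ctxOf G v t) (hle : s v ≤ t v) :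
    mon G K v s = mon G K v t := by
  rw [aux_mon_eq, aux_mon_eq]
  have hfun : ∀ j, ctxOf G v (Function.update s v j) = ctxOf G v (Function.update t v j) := by
    intro j
    funext u
    by_cases hu : u = v
    · subst hu
      apply aux_ctx_congr; simp
    · rw [aux_ctx_congr G v (Function.update s v j) s u (by simp [hu]),
        aux_ctx_congr G v (Function.update t v j) t u (by simp [hu]), h]
  simp only [hfun]
  apply aux_target_const (k := K v (ctxOf G v t)) _ hle
  intro z hz1 hz2
  have : ctxOf G v (Function.update t v z) = ctxOf G v t := by
    funext u
    by_cases hu : u = v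
    · subst hu
      obtain ⟨h1, h2, h3⟩ := aux_ctx_spec G u t u (ht u)
      obtain ⟨h4, h5, h6⟩ := aux_ctx_spec G u s u (hs u)
      rw [h] at h5
      apply aux_ctx_eq G u _ u h1
      · simp; omega
      · simp; omega
    · rw [aux_ctx_congr G v _ t u (by simp [hu])]
  simp only [this]

theorem aux_mon_const (G : RegGraph V ρ) (K : Param V) (v : V) (s t : V → ℕ)
    (hs : s ∈ States ρ) (ht : t ∈ States ρ) (h : ctxOf G v s = ctxOf G v t) :
    mon G K v s = mon G K v t := by
  rcases le_total (s v) (t v) with hle | hle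
  · exact aux_mon_const_le G K v s t hs ht h hle
  · exact (aux_mon_const_le G K v t s ht hs h.symm hle).symm

theorem aux_F_le (G : RegGraph V ρ) (K : Param V) (hK : IsParam G K) (v : V) (s : V → ℕ)
    (hs : s ∈ States ρ) : F G K v s ≤ ρ v := by
  have h1 := hK v _ (aux_ctx_mem G v s hs)
  have h2 := hs v
  unfold F
  split_ifs <;> omega

theorem aux_update_state {s : V → ℕ} (hs : s ∈ States ρ) {v : V} {j : ℕ} (hj : j ≤ ρ v) :
    Function.update s v j ∈ States ρ := by
  intro u
  by_cases hu : u = v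
  · subst hu; simpa using hj
  · simpa [hu] using hs u

theorem aux_F_ts {G G' : RegGraph V ρ} {K K' : Param V} (hK : IsParam G K)
    (hT : TS G' K' = TS G K) {v : V} {s : V → ℕ}
    (hs : s ∈ States ρ) (hne : F G K v s ≠ s v) : F G K v s = F G' K' v s := by
  have hmem : (s, Function.update s v (F G K v s)) ∈ TS G K := by
    refine ⟨hs, aux_update_state hs (aux_F_le G K hK v s hs), ?_, v, rfl⟩
    intro h
    have := congrFun h v
    simp at this
    exact hne this.symm
  rw [← hT] at hmem
  obtain ⟨_, _, _, w, hw⟩ := hmem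
  have := congrFun hw v
  by_cases hwv : v = w
  · subst hwv; simpa using this
  · simp [hwv] at this
    exact absurd this hne

theorem aux_delta_ts {G G' : RegGraph V ρ} {K K' : Param V} (hK : IsParam G K)
    (hK' : IsParam G' K') (hT : TS G' K' = TS G K) (v : V) {s : V → ℕ}
    (hs : s ∈ States ρ) : delta G K v s = delta G' K' v s := by
  unfold delta
  by_cases h : F G K v s = s v
  · by_cases h' : F G' K' v s = s v
    · rw [h, h']
    · rw [aux_F_ts hK' hT.symm hs h']
  · rw [aux_F_ts hK hT hs h]

theorem aux_delta_top (G : RegGraph V ρ) (K : Param V) (hK : IsParam G K) (v : V) (s : V → ℕ)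
    (hs : s ∈ States ρ) : delta G K v (Function.update s v (ρ v)) ≠ 1 := by
  rw [ne_eq, aux_delta_lt]
  have := hK v _ (aux_ctx_mem G v _ (aux_update_state (v := v) hs le_rfl))
  simp
  exact this

theorem aux_sInf_le_of {A B : Set ℕ} {r : ℕ} (hA : r ∈ A)
    (h : ∀ j ≤ r, j ∈ A → j ∈ B) : sInf B ≤ sInf A :=
  Nat.sInf_le (h _ (Nat.sInf_le hA) (Nat.sInf_mem ⟨r, hA⟩))

theorem aux_mon_ts {G G' : RegGraph V ρ} {K K' : Param V} (hK : IsParam G K)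
    (hK' : IsParam G' K') (hT : TS G' K' = TS G K) (v : V) {s : V → ℕ}
    (hs : s ∈ States ρ) : mon G K v s = mon G' K' v s := by
  have hd : ∀ j ≤ ρ v, delta G K v (Function.update s v j)
      = delta G' K' v (Function.update s v j) := fun j hj =>
    aux_delta_ts hK hK' hT v (aux_update_state hs hj)
  unfold mon
  rw [← aux_delta_ts hK hK' hT v hs]
  by_cases h0 : delta G K v s = 0
  · simp [h0]
  rw [if_neg h0, if_neg h0]
  by_cases h1 : delta G K v s = 1
  · rw [if_pos h1, if_pos h1]
    have hlt : s v < ρ v := by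
      rw [aux_delta_lt] at h1
      exact lt_of_lt_of_le h1 (hK v _ (aux_ctx_mem G v s hs))
    apply le_antisymm
    · refine aux_sInf_le_of (r := ρ v) (by exact ⟨hlt, aux_delta_top G' K' hK' v s hs⟩) ?_
      rintro j hj ⟨h2, h3⟩
      exact ⟨h2, by rw [hd j hj]; exact h3⟩
    · refine aux_sInf_le_of (r := ρ v) (by exact ⟨hlt, aux_delta_top G K hK v s hs⟩) ?_
      rintro j hj ⟨h2, h3⟩
      exact ⟨h2, by rw [← hd j hj]; exact h3⟩
  · rw [if_neg h1, if_neg h1]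
    congr 1
    ext j
    simp only [Set.mem_setOf_eq]
    constructor
    · rintro ⟨h2, h3⟩
      exact ⟨h2, by rw [← hd j (by have := hs v; omega)]; exact h3⟩
    · rintro ⟨h2, h3⟩
      exact ⟨h2, by rw [hd j (by have := hs v; omega)]; exact h3⟩

/-- invariant of the minimization -/
def AuxInv (M : V → (V → ℕ) → ℕ) (P : RegGraph V ρ × Param V) : Prop :=
  ∀ v : V, ∀ s ∈ States ρ, P.2 v (ctxOf P.1 v s) = M v s

theorem aux_corner_state (G : RegGraph V ρ) (v : V) {ω : V → ℕ × ℕ} (hω : ω ∈ Context G v) :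
    (fun u => (ω u).1) ∈ States ρ := by
  intro u
  have h1 := aux_theta_le G u v (hω u).2.1
  have h2 := (hω u).2.2.1
  simp only
  omega

theorem aux_corner_ctx (G : RegGraph V ρ) (v : V) {ω : V → ℕ × ℕ} (hω : ω ∈ Context G v) :
    ctxOf G v (fun u => (ω u).1) = ω := by
  funext u
  exact aux_ctx_eq G v _ u (hω u) le_rfl (hω u).2.2.1

theorem aux_inv_norm (G : RegGraph V ρ) (K : Param V) :
    AuxInv (mon G K) (G, NormPm G K) := by
  intro v s hs
  have hω := aux_ctx_mem G v s hs
  exact aux_mon_const G K v _ s (aux_corner_state G v hω) hs (aux_corner_ctx G v hω)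

theorem aux_nminus_act (G : RegGraph V ρ) {u v : V} {n : ℕ} (he : (u, n, v) ∈ G.E) :
    (nminus G u v n, n) ∈ ActInterval G u v := by
  have hn := (G.valid _ he).1
  simp only at hn
  have h1 : nminus G u v n ∈ {m | m ∈ Theta G u v ∧ m < n} :=
    Nat.sSup_mem ⟨0, aux_theta_zero G u v, hn⟩ ⟨n, fun x hx => hx.2.le⟩
  refine ⟨h1.1, Or.inl he, h1.2, ?_⟩
  rintro l hl ⟨h2, h3⟩
  have : l ≤ nminus G u v n := le_csSup ⟨n, fun x hx => hx.2.le⟩ ⟨hl, h3⟩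
  simp only at h2
  omega

theorem aux_nplus_act (G : RegGraph V ρ) {u v : V} {n : ℕ} (he : (u, n, v) ∈ G.E) :
    (n, nplus G u v n) ∈ ActInterval G u v := by
  have hn := (G.valid _ he).2
  simp only at hn
  have h1 : nplus G u v n ∈ {m | m ∈ Theta G u v ∧ n < m} :=
    Nat.sInf_mem ⟨ρ u + 1, aux_theta_top G u v, by omega⟩
  refine ⟨Or.inl he, h1.1, h1.2, ?_⟩
  rintro l hl ⟨h2, h3⟩
  have : nplus G u v n ≤ l := Nat.sInf_le ⟨hl, h2⟩
  simp only at h3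
  omega

theorem aux_ctx_theta {G H : RegGraph V ρ} {u v : V} (h : Theta H u v = Theta G u v)
    (s : V → ℕ) : ctxOf H v s u = ctxOf G v s u := by
  simp [ctxOf, h]

theorem aux_inv_step (M : V → (V → ℕ) → ℕ) (G H : RegGraph V ρ) (N : Param V) (u v : V) (n : ℕ)
    (he : (u, n, v) ∈ G.E) (hno : NotObsParam G N (u, n, v))
    (hH : ∀ e, e ∈ H.E ↔ e ≠ (u, n, v) ∧ e ∈ G.E)
    (hI : AuxInv M (G, N)) : AuxInv M (H, MinParam G N (u, n, v)) := by
  have hT : ∀ x w, (x ≠ u ∨ w ≠ v) → Theta H x w = Theta G x w := by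
    intro x w hxw
    ext m
    simp only [Theta, Set.mem_union, Set.mem_setOf_eq, hH, ne_eq, Prod.mk.injEq]
    have : ¬ (x = u ∧ m = n ∧ w = v) := by tauto
    simp [this]
  have hval := G.valid _ he
  simp only at hval
  have hTu : ∀ m, m ∈ Theta H u v ↔ m ≠ n ∧ m ∈ Theta G u v := by
    intro m
    simp only [Theta, Set.mem_union, Set.mem_setOf_eq, hH, ne_eq, Prod.mk.injEq,
      Set.mem_insert_iff, Set.mem_singleton_iff]
    have : m = 0 ∨ m = ρ u + 1 → m ≠ n := by omega
    tauto
  intro w s hs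
  have hI' := hI w s hs
  simp only at hI' ⊢
  unfold MinParam
  by_cases hw : w = v
  swap
  · have : ctxOf H w s = ctxOf G w s := by
      funext x
      exact aux_ctx_theta (hT x w (Or.inr hw)) s
    simp only [hw, false_and, if_false, this, hI']
  subst hw
  have ha := aux_nminus_act G he
  have hb := aux_nplus_act G he
  simp only [true_and]
  set a := nminus G u w n with ha_def
  set b := nplus G u w n with hb_def
  have han : a < n := ha.2.2.1
  have hnb : n < b := hb.2.2.1
  have hab : (a, b) ∈ ActInterval H u w := by
    refine ⟨(hTu a).2 ⟨by omega, ha.1⟩, (hTu b).2 ⟨by omega, hb.2.1⟩, by simp only; omega, ?_⟩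
    rintro l hl ⟨h1, h2⟩
    rw [hTu] at hl
    have h3 := ha.2.2.2 l hl.2
    have h4 := hb.2.2.2 l hl.2
    simp only at h1 h2 h3 h4
    omega
  have hx : ∀ x, x ≠ u → ctxOf H w s x = ctxOf G w s x := fun x hx =>
    aux_ctx_theta (hT x w (Or.inl hx)) s
  have hupd : ∀ p, Function.update (ctxOf H w s) u p = Function.update (ctxOf G w s) u p := by
    intro p
    funext x
    by_cases hxu : x = u
    · subst hxu; simp
    · simp [hxu, hx x hxu]
  by_cases hin : a ≤ s u ∧ s u < b
  · have hc : ctxOf H w s u = (a, b) := aux_ctx_eq H w s u hab hin.1 hin.2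
    rw [if_pos hc, hupd, ← hI']
    by_cases hlt : s u < n
    · have : ctxOf G w s u = (a, n) := aux_ctx_eq G w s u ha hin.1 hlt
      rw [← this, Function.update_eq_self]
    · have : ctxOf G w s u = (n, b) := aux_ctx_eq G w s u hb (by simp only; omega) hin.2
      exact (hno _ (aux_ctx_mem G w s hs) this).symm
  · obtain ⟨h1, h2, h3⟩ := aux_ctx_spec H w s u (hs u)
    have hc : ctxOf H w s u ≠ (a, b) := by
      intro h
      rw [h] at h2 h3
      exact hin ⟨h2, h3⟩
    rw [if_neg hc]
    obtain ⟨g1, g2, g3⟩ := aux_ctx_spec G w s u (hs u)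
    have e1 : (ctxOf G w s u).1 ≠ n := by
      intro h
      have := aux_act_unique G u w (x := n) g1 hb (by omega) (by have := g1.2.2.1; omega)
        le_rfl hnb
      rw [this] at g2 g3
      simp only at g2 g3
      exact hin ⟨by omega, g3⟩
    have e2 : (ctxOf G w s u).2 ≠ n := by
      intro h
      have := aux_act_unique G u w (x := n - 1) g1 ha (by have := g1.2.2.1; omega) (by omega)
        (by simp only; omega) (by simp only; omega)
      rw [this] at g2 g3
      simp only at g2 g3
      exact hin ⟨g2, by omega⟩
    have hgH : ctxOf G w s u ∈ ActInterval H u w :=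
      ⟨(hTu _).2 ⟨e1, g1.1⟩, (hTu _).2 ⟨e2, g1.2.1⟩, g1.2.2.1,
        fun l hl => g1.2.2.2 l ((hTu l).1 hl).2⟩
    have : ctxOf H w s = ctxOf G w s := by
      funext x
      by_cases hxu : x = u
      · subst hxu
        exact aux_ctx_eq H w s x hgH g2 g3
      · exact hx x hxu
    rw [this, hI']

theorem aux_inv_step' (M : V → (V → ℕ) → ℕ) (G H : RegGraph V ρ) (N : Param V) (e : V × ℕ × V)
    (he : e ∈ G.E) (hno : NotObsParam G N e)
    (hH : ∀ e', e' ∈ H.E ↔ e' ≠ e ∧ e' ∈ G.E)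
    (hI : AuxInv M (G, N)) : AuxInv M (H, MinParam G N e) := by
  obtain ⟨u, n, v⟩ := e
  exact aux_inv_step M G H N u v n he hno hH hI

theorem aux_obs_edge (G G' : RegGraph V ρ) (N K' : Param V)
    (hI : AuxInv (mon G' K') (G, N)) (e : V × ℕ × V) (he : e ∈ G.E)
    (hobs : ¬ NotObsParam G N e) : e ∈ G'.E := by
  obtain ⟨u, n, v⟩ := e
  by_contra hcon
  apply hobs
  intro ω hω hωu
  simp only at hω hωu ⊢
  have ha := aux_nminus_act G he
  have hval := G.valid _ he
  simp only at hval
  have han : nminus G u v n < n := ha.2.2.1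
  have hs := aux_corner_state G v hω
  have hsc := aux_corner_ctx G v hω
  set s : V → ℕ := fun u => (ω u).1 with hs_def
  have hsu : s u = n := by simp [hs_def, hωu]
  have ht : Function.update s u (n - 1) ∈ States ρ := aux_update_state hs (by omega)
  have htc : ctxOf G v (Function.update s u (n - 1))
      = Function.update ω u (nminus G u v n, n) := by
    funext x
    by_cases hxu : x = u
    · subst hxu
      rw [Function.update_self]
      apply aux_ctx_eq G v _ x ha
      · simp; omega
      · simp; omega
    · rw [aux_ctx_congr G v _ s x (by simp [hxu]), hsc]
      simp [hxu]
  have h1 := hI v s hs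
  have h2 := hI v _ ht
  simp only [hsc] at h1
  simp only [htc] at h2
  rw [h1, h2]
  apply aux_mon_const G' K' v _ _ hs ht
  funext x
  by_cases hxu : x = u
  · subst hxu
    obtain ⟨g1, g2, g3⟩ := aux_ctx_spec G' v (Function.update s x (n - 1)) x (ht x)
    rw [Function.update_self] at g2 g3
    apply aux_ctx_eq G' v _ x g1
    · omega
    · have hne : (ctxOf G' v (Function.update s x (n - 1)) x).2 ≠ n := by
        intro h
        have hm := g1.2.1
        rw [h] at hm
        simp only [Theta, Set.mem_union, Set.mem_setOf_eq, Set.mem_insert_iff,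
          Set.mem_singleton_iff] at hm
        rcases hm with hm | hm | hm
        · exact hcon hm
        · omega
        · omega
      omega
  · exact aux_ctx_congr G' v _ _ x (by simp [hxu])

theorem aux_minim_cases [LinearOrder (V × ℕ × V)] (M : V → (V → ℕ) → ℕ)
    (P : RegGraph V ρ × Param V) (hI : AuxInv M P) :
    AuxInv M (Minim P) ∧ ((Minim P).1.E.card < P.1.E.card ∨
      (Minim P = P ∧ ∀ e ∈ P.1.E, ¬ NotObsParam P.1 P.2 e)) := by
  unfold Minim
  split_ifs with h
  · have hm := Finset.min'_mem _ h
    have hm' := Finset.mem_filter.mp hm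
    refine ⟨?_, Or.inl ?_⟩
    · exact aux_inv_step' M P.1 _ P.2 _ hm'.1 hm'.2 (fun e => Finset.mem_erase) hI
    · exact Finset.card_erase_lt_of_mem hm'.1
  · refine ⟨hI, Or.inr ⟨rfl, ?_⟩⟩
    intro e he hno
    exact h ⟨e, Finset.mem_filter.mpr ⟨he, hno⟩⟩

theorem aux_reach [LinearOrder (V × ℕ × V)] (M : V → (V → ℕ) → ℕ) (c : ℕ) :
    ∀ P : RegGraph V ρ × Param V, P.1.E.card ≤ c → AuxInv M P →
    ∃ m : ℕ, Minim (Minim^[m] P) = Minim^[m] P ∧ AuxInv M (Minim^[m] P) ∧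
      ∀ e ∈ (Minim^[m] P).1.E, ¬ NotObsParam (Minim^[m] P).1 (Minim^[m] P).2 e := by
  induction c with
  | zero =>
    intro P hP hI
    obtain ⟨h1, h2 | h2⟩ := aux_minim_cases M P hI
    · omega
    · exact ⟨0, h2.1, hI, h2.2⟩
  | succ c ih =>
    intro P hP hI
    obtain ⟨h1, h2 | h2⟩ := aux_minim_cases M P hI
    · obtain ⟨m, hm⟩ := ih (Minim P) (by omega) h1
      exact ⟨m + 1, hm⟩
    · exact ⟨0, h2.1, hI, h2.2⟩

/-- The sequence of iterated minimizations started at the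
normalization of `(G,K)` becomes constant after finitely many steps at a fixed
point `(G^m, N^m)`, and `G^m` is minimal: no parametrized regulatory graph with
fewer edges generates the transition system `T_G(K)`. -/
theorem minimization_converges_minimal {V : Type*} [DecidableEq V] [Fintype V]
    [LinearOrder (V × ℕ × V)] {ρ : V → ℕ} (hρ : ∀ v, 1 ≤ ρ v)
    (G : RegGraph V ρ) (K : Param V) (hK : IsParam G K) :
    ∃ m : ℕ,
      (∀ k : ℕ, m ≤ k → Minim^[k] (G, NormPm G K) = Minim^[m] (G, NormPm G K)) ∧
      Minim (Minim^[m] (G, NormPm G K)) = Minim^[m] (G, NormPm G K) ∧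
      ¬ ∃ (G' : RegGraph V ρ) (K' : Param V), IsParam G' K' ∧
          TS G' K' = TS G K ∧ G'.E.card < (Minim^[m] (G, NormPm G K)).1.E.card := by
  obtain ⟨m, h1, h2, h3⟩ := aux_reach (mon G K) _ (G, NormPm G K) le_rfl (aux_inv_norm G K)
  refine ⟨m, ?_, h1, ?_⟩
  · intro k hk
    obtain ⟨d, rfl⟩ := Nat.exists_eq_add_of_le hk
    rw [Nat.add_comm, Function.iterate_add_apply]
    exact Function.iterate_fixed h1 d
  · rintro ⟨G', K', hK', hT, hcard⟩
    have hI : AuxInv (mon G' K') (Minim^[m] (G, NormPm G K)) := by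
      intro v s hs
      rw [h2 v s hs]
      exact aux_mon_ts hK hK' hT v hs
    have hsub : (Minim^[m] (G, NormPm G K)).1.E ⊆ G'.E := fun e he =>
      aux_obs_edge _ G' _ K' hI e he (h3 e he)
    have := Finset.card_le_card hsub
    omega

end MVReg
end
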